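/- Under the AOA algorithm (losses valued in [0,1], convex, G-Lipschitz gradients, domain diameter at most D), for every interval J = [i,j] in the geometric covering collection 𝓘, the meta-regret satisfies Σ_{t=i}^{j} f_t(w_t) − Σ_{t=i}^{j} f_t(w_{t,J}) ≤ √( 3·(j−i+1)·c'(j) ), where c'(j) = 1 + ln j + ln(1 + log₂ j) + ln( (5 + 3 ln(1+j))/2 ) and w_{t,J} is the action of the expert associated with J at round t. -/

import Mathlib

/-- The AdaNormalHedge potential `Φ(R,C) = exp([R]₊²/(3C))` (with `Φ(R,0) = 1`,
matching `Φ(0,0) = 1`, since `x/0 = 0` in Lean). -/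
noncomputable def anhPot (R C : ℝ) : ℝ := Real.exp (max R 0 ^ 2 / (3 * C))

/-- The AdaNormalHedge weight function `w(R,C) = (Φ(R+1,C+1) − Φ(R−1,C+1))/2`. -/
noncomputable def anhW (R C : ℝ) : ℝ := (anhPot (R + 1) (C + 1) - anhPot (R - 1) (C + 1)) / 2

/-- The number of experts of Ader with horizon `m`: `N = ⌈(1/2)log₂(1 + 4m/7)⌉ + 1`. -/
noncomputable def aderN (m : ℕ) : ℕ := ⌈Real.logb 2 (1 + 4 * (m : ℝ) / 7) / 2⌉₊ + 1

/-- The `j`-th step size of Ader with horizon `m`: `η_j = 2^{j−1}(D/G)√(7/(2m))`. -/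
noncomputable def aderEta (D G : ℝ) (m j : ℕ) : ℝ :=
  2 ^ (j - 1) * (D / G) * Real.sqrt (7 / (2 * (m : ℝ)))

/-- The Hedge learning rate of Ader with horizon `m`: `α = √(8/m)`. -/
noncomputable def aderAlpha (m : ℕ) : ℝ := Real.sqrt (8 / (m : ℝ))

/-- The levels `k` whose geometric covering interval `[i·2^k, (i+1)·2^k − 1] ∈ 𝓘_k`
containing round `t` has index `i = ⌊t/2^k⌋ ≥ 1`; these index the experts of AOA
active at round `t` (one per level). -/
def gcLevels (t : ℕ) : Finset ℕ := (Finset.range (t + 1)).filter fun k => 2 ^ k ≤ t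

/-- `R_{t−1,I} = Σ_{u=min I}^{t−1} (f_u(w_u) − f_u(w_{u,I}))` for the active level-`k`
expert at round `t`, whose interval `I ∈ 𝓘_k` has index `⌊t/2^k⌋` and starts at
`⌊t/2^k⌋·2^k`; `wI k i u` is the action at round `u` of the Ader expert associated
with the `i`-th interval of level `k`. -/
noncomputable def aoaMetaR {α : Type*} (f : ℕ → α → ℝ) (w : ℕ → α)
    (wI : ℕ → ℕ → ℕ → α) (k t : ℕ) : ℝ :=
  ∑ u ∈ Finset.Icc (t / 2 ^ k * 2 ^ k) (t - 1), (f u (w u) - f u (wI k (t / 2 ^ k) u))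

/-- `C_{t−1,I} = Σ_{u=min I}^{t−1} |f_u(w_u) − f_u(w_{u,I})|` for the active level-`k`
expert at round `t`. -/
noncomputable def aoaMetaC {α : Type*} (f : ℕ → α → ℝ) (w : ℕ → α)
    (wI : ℕ → ℕ → ℕ → α) (k t : ℕ) : ℝ :=
  ∑ u ∈ Finset.Icc (t / 2 ^ k * 2 ^ k) (t - 1), |f u (w u) - f u (wI k (t / 2 ^ k) u)|

/-- The AdaNormalHedge weight `p_{t,I}` that AOA assigns to the active level-`k`
expert at round `t`. -/
noncomputable def aoaWeight {α : Type*} (f : ℕ → α → ℝ) (w : ℕ → α)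
    (wI : ℕ → ℕ → ℕ → α) (k t : ℕ) : ℝ :=
  anhW (aoaMetaR f w wI k t) (aoaMetaC f w wI k t) /
    ∑ k' ∈ gcLevels t, anhW (aoaMetaR f w wI k' t) (aoaMetaC f w wI k' t)

/-- `c'(t) = 1 + ln t + ln(1 + log₂ t) + ln((5 + 3 ln(1+t))/2)`. -/
noncomputable def cAOA (t : ℕ) : ℝ :=
  1 + Real.log t + Real.log (1 + Real.logb 2 t) + Real.log ((5 + 3 * Real.log (1 + (t : ℝ))) / 2)

open Finset

/-- One-dimensional perspective convexity: `x² / c` is jointly convex. -/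
lemma sq_div_perspective_le {x y z C a : ℝ} (hz0 : 0 ≤ z) (hC : 0 ≤ C) (hxC : C = 0 → x = 0)
    (ha0 : 0 ≤ a) (ha1 : a ≤ 1) (hz : z ≤ (1 - a) * x + a * y) :
    z ^ 2 / (3 * (C + a)) ≤ (1 - a) * (x ^ 2 / (3 * C)) + a * (y ^ 2 / (3 * (C + 1))) := by
  have hzsq : z ^ 2 ≤ ((1 - a) * x + a * y) ^ 2 := pow_le_pow_left₀ hz0 hz 2
  rcases hC.eq_or_lt with h | h
  · have hx := hxC h.symm
    subst hx
    subst h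
    rcases ha0.eq_or_lt with h' | h'
    · subst h'
      simp
    · rw [zero_add, zero_add, div_le_iff₀ (by positivity)]
      simp only [mul_zero, zero_add] at hzsq
      calc z ^ 2 ≤ (a * y) ^ 2 := hzsq
        _ = _ := by ring
  · have h1 : 0 < C + a := by linarith
    rw [div_le_iff₀ (by positivity)]
    refine hzsq.trans ?_
    have key : ((1 - a) * (x ^ 2 / (3 * C)) + a * (y ^ 2 / (3 * (C + 1)))) * (3 * (C + a))
        - ((1 - a) * x + a * y) ^ 2
        = a * (1 - a) * (x * (C + 1) - y * C) ^ 2 / (C * (C + 1)) := by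
      field_simp
      ring
    have : 0 ≤ a * (1 - a) * (x * (C + 1) - y * C) ^ 2 / (C * (C + 1)) := by
      have : 0 ≤ 1 - a := by linarith
      positivity
    linarith

lemma one_le_anhPot {R C : ℝ} (hC : 0 ≤ C) : 1 ≤ anhPot R C := by
  unfold anhPot
  exact Real.one_le_exp (by positivity)

lemma anhPot_convex_step {R C a σ : ℝ} (hR : |R| ≤ C) (ha0 : 0 ≤ a) (ha1 : a ≤ 1) :
    anhPot (R + σ * a) (C + a) ≤ (1 - a) * anhPot R C + a * anhPot (R + σ) (C + 1) := by
  have hC : 0 ≤ C := (abs_nonneg R).trans hR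
  have h1a : 0 ≤ 1 - a := by linarith
  unfold anhPot
  have h := sq_div_perspective_le (x := max R 0) (y := max (R + σ) 0) (z := max (R + σ * a) 0)
    (le_max_right _ _) hC
    (fun h => by
      have : R = 0 := abs_eq_zero.mp (le_antisymm (h ▸ hR) (abs_nonneg _))
      simp [this]) ha0 ha1
    (by
      refine max_le ?_ (by positivity)
      nlinarith [mul_le_mul_of_nonneg_left (le_max_left R 0) h1a,
        mul_le_mul_of_nonneg_left (le_max_left (R + σ) 0) ha0])
  have hc := convexOn_exp.2 (Set.mem_univ (max R 0 ^ 2 / (3 * C)))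
    (Set.mem_univ (max (R + σ) 0 ^ 2 / (3 * (C + 1)))) h1a ha0 (by ring)
  simp only [smul_eq_mul] at hc
  exact (Real.exp_le_exp.mpr h).trans hc

lemma exp_four_mul_le {x : ℝ} (h0 : 0 ≤ x) (h1 : x ≤ 1 / 3) : Real.exp (4 * x) ≤ 1 + 9 * x := by
  have hc := convexOn_exp.2 (Set.mem_univ (0 : ℝ)) (Set.mem_univ (4 / 3 : ℝ))
    (show 0 ≤ 1 - 3 * x by linarith) (show 0 ≤ 3 * x by linarith) (by ring)
  simp only [smul_eq_mul, mul_zero, zero_add, Real.exp_zero, mul_one] at hc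
  have he : Real.exp (4 / 3) ≤ 4 := by
    have h3 : Real.exp (4 / 3) ^ 3 = Real.exp 1 ^ 4 := by
      rw [← Real.exp_nat_mul, ← Real.exp_nat_mul]
      norm_num
    have h4 : Real.exp 1 ^ 4 ≤ 2.7182818286 ^ 4 :=
      pow_le_pow_left₀ (Real.exp_pos 1).le Real.exp_one_lt_d9.le 4
    refine le_of_pow_le_pow_left₀ (n := 3) (by norm_num) (by norm_num) ?_
    rw [h3]
    refine h4.trans ?_
    norm_num
  rw [show 3 * x * (4 / 3) = 4 * x by ring] at hc
  nlinarith

lemma exp_add_exp_le {R C : ℝ} (hR1 : 1 ≤ R) (hRC : R ≤ C) :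
    Real.exp ((R + 1) ^ 2 / (3 * (C + 1))) + Real.exp ((R - 1) ^ 2 / (3 * (C + 1)))
      ≤ 2 * Real.exp (R ^ 2 / (3 * C)) + 3 / (C + 1) := by
  have hC : 0 < C := by linarith
  set s : ℝ := R ^ 2 / (3 * (C + 1)) with hs
  set e : ℝ := 1 / (3 * (C + 1)) with he
  have hs0 : 0 ≤ s := by positivity
  have he0 : 0 < e := by positivity
  have he6 : e ≤ 1 / 6 := by
    rw [he]
    exact one_div_le_one_div_of_le (by norm_num) (by linarith)
  have hsum : Real.exp ((R + 1) ^ 2 / (3 * (C + 1))) + Real.exp ((R - 1) ^ 2 / (3 * (C + 1)))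
      ≤ 2 * Real.exp (s + e + 2 * s * e) := by
    have h := Real.cosh_le_exp_half_sq (2 * R * e)
    rw [Real.cosh_eq] at h
    have h1 : (R + 1) ^ 2 / (3 * (C + 1)) = (s + e) + 2 * R * e := by
      rw [hs, he]; field_simp; ring
    have h2 : (R - 1) ^ 2 / (3 * (C + 1)) = (s + e) + -(2 * R * e) := by
      rw [hs, he]; field_simp; ring
    have h3 : (2 * R * e) ^ 2 / 2 = 2 * s * e := by
      rw [hs, he]; field_simp
    rw [h3] at h
    rw [h1, h2, Real.exp_add (s + e), Real.exp_add (s + e), Real.exp_add (s + e)]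
    nlinarith [Real.exp_pos (s + e)]
  have hA : s + 3 * s * e ≤ R ^ 2 / (3 * C) := by
    rw [hs, he, ← sub_nonneg]
    have : R ^ 2 / (3 * C) - (R ^ 2 / (3 * (C + 1)) + 3 * (R ^ 2 / (3 * (C + 1))) *
        (1 / (3 * (C + 1)))) = R ^ 2 / (3 * C * (C + 1) ^ 2) := by
      field_simp
      ring
    rw [this]
    positivity
  have hA' := Real.exp_le_exp.mpr hA
  have h3 : 3 / (C + 1) = 9 * e := by rw [he]; field_simp; norm_num
  rw [h3]
  suffices Real.exp (s + e + 2 * s * e) ≤ Real.exp (s + 3 * s * e) + 9 / 2 * e by linarith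
  rcases le_or_gt 1 s with h | h
  · have : Real.exp (s + e + 2 * s * e) ≤ Real.exp (s + 3 * s * e) :=
      Real.exp_le_exp.mpr (by nlinarith)
    linarith
  · have hexp : Real.exp (s + 3 * s * e)
        = Real.exp (s + e + 2 * s * e) * Real.exp (-((1 - s) * e)) := by
      rw [← Real.exp_add]
      congr 1
      ring
    have hlin : 1 - (1 - s) * e ≤ Real.exp (-((1 - s) * e)) := by
      linarith [Real.add_one_le_exp (-((1 - s) * e))]
    have hle : (1 - s) * Real.exp (s + e + 2 * s * e) ≤ 9 / 2 := by
      have h1 : (1 - s) * Real.exp s ≤ 1 := by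
        have := Real.add_one_le_exp (-s)
        calc (1 - s) * Real.exp s ≤ Real.exp (-s) * Real.exp s := by
              gcongr
              linarith
          _ = 1 := by rw [← Real.exp_add]; simp
      have h2 : Real.exp (e + 2 * s * e) ≤ Real.exp 1 := Real.exp_le_exp.mpr (by nlinarith)
      have h4 := Real.exp_one_lt_d9
      rw [show s + e + 2 * s * e = s + (e + 2 * s * e) by ring, Real.exp_add, ← mul_assoc]
      nlinarith [Real.exp_pos (e + 2 * s * e)]
    rw [hexp]
    nlinarith [mul_le_mul_of_nonneg_left hlin (Real.exp_pos (s + e + 2 * s * e)).le,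
      mul_le_mul_of_nonneg_left hle he0.le]

lemma anhPot_add_anhPot_le {R C : ℝ} (hR : |R| ≤ C) :
    anhPot (R + 1) (C + 1) + anhPot (R - 1) (C + 1) ≤ 2 * anhPot R C + 3 / (C + 1) := by
  have hC : 0 ≤ C := (abs_nonneg R).trans hR
  rcases le_or_gt R 1 with h | h
  · have h1 : anhPot (R - 1) (C + 1) = 1 := by
      unfold anhPot
      rw [max_eq_right (by linarith)]
      simp
    have h2 : anhPot (R + 1) (C + 1) ≤ 1 + 3 / (C + 1) := by
      have hx := exp_four_mul_le (x := 1 / (3 * (C + 1))) (by positivity)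
        (one_div_le_one_div_of_le (by norm_num) (by linarith))
      have h3 : 1 + 9 * (1 / (3 * (C + 1))) = 1 + 3 / (C + 1) := by field_simp; ring
      rw [h3] at hx
      refine le_trans ?_ hx
      unfold anhPot
      refine Real.exp_le_exp.mpr ?_
      rw [mul_one_div]
      gcongr
      have h4 : max (R + 1) 0 ≤ 2 := max_le (by linarith) (by norm_num)
      nlinarith [le_max_right (R + 1) 0]
    have := one_le_anhPot (R := R) hC
    linarith
  · unfold anhPot
    rw [max_eq_left (by linarith), max_eq_left (by linarith), max_eq_left (by linarith)]
    exact exp_add_exp_le h.le ((le_abs_self R).trans hR)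

/-- The one-step inequality of the AdaNormalHedge potential. -/
lemma anhPot_step {R C r : ℝ} (hR : |R| ≤ C) (hr : |r| ≤ 1) :
    anhPot (R + r) (C + |r|) ≤ anhPot R C + anhW R C * r + 3 / 2 * (|r| / (C + 1)) := by
  have hsum := mul_le_mul_of_nonneg_left (anhPot_add_anhPot_le hR) (abs_nonneg r)
  have h3 : 3 / (C + 1) = 3 * (1 / (C + 1)) := by ring
  have h4 : |r| / (C + 1) = |r| * (1 / (C + 1)) := by ring
  rw [h3] at hsum
  rw [h4]
  unfold anhW
  rcases abs_cases r with ⟨h, _⟩ | ⟨h, _⟩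
  · have := anhPot_convex_step (σ := 1) hR (abs_nonneg r) hr
    rw [h, one_mul] at this
    rw [h] at hsum ⊢
    linarith
  · have := anhPot_convex_step (σ := -1) hR (abs_nonneg r) hr
    rw [h, neg_one_mul, neg_neg, ← sub_eq_add_neg R 1] at this
    rw [h] at hsum ⊢
    linarith

lemma anhW_nonneg {R C : ℝ} (hC : 0 ≤ C) : 0 ≤ anhW R C := by
  have h : anhPot (R - 1) (C + 1) ≤ anhPot (R + 1) (C + 1) := by
    unfold anhPot
    refine Real.exp_le_exp.mpr ?_
    gcongr
    linarith
  unfold anhW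
  linarith

lemma anhW_zero_pos : 0 < anhW 0 0 := by
  have h : anhPot (0 - 1) (0 + 1) < anhPot (0 + 1) (0 + 1) := by
    unfold anhPot
    refine Real.exp_lt_exp.mpr ?_
    norm_num
  exact half_pos (sub_pos.mpr h)

lemma div_one_add_le_log_sub {C a : ℝ} (hC : 0 ≤ C) (ha0 : 0 ≤ a) (ha1 : a ≤ 1) :
    a / (C + 1) ≤ (Real.log (1 + (C + a)) - 1 / (1 + (C + a))) -
      (Real.log (1 + C) - 1 / (1 + C)) := by
  have hlog := Real.one_sub_inv_le_log_of_pos (x := (1 + (C + a)) / (1 + C)) (by positivity)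
  rw [Real.log_div (by positivity) (by positivity)] at hlog
  have key : (1 - ((1 + (C + a)) / (1 + C))⁻¹) + (1 / (1 + C) - 1 / (1 + (C + a))) - a / (C + 1)
      = a * (1 - a) / ((1 + C) * (1 + (C + a))) := by
    field_simp
    ring
  have : 0 ≤ a * (1 - a) / ((1 + C) * (1 + (C + a))) := by
    have : 0 ≤ 1 - a := by linarith
    positivity
  linarith

/-- AdaNormalHedge potential after `n` rounds with instantaneous regrets `r`. -/
lemma anhPot_sum_le (r : ℕ → ℝ) (hr : ∀ u, |r u| ≤ 1) (n : ℕ) :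
    anhPot (∑ u ∈ range n, r u) (∑ u ∈ range n, |r u|) ≤
      1 + ∑ v ∈ range n, anhW (∑ u ∈ range v, r u) (∑ u ∈ range v, |r u|) * r v +
        3 / 2 * (Real.log (1 + ∑ u ∈ range n, |r u|) - 1 / (1 + ∑ u ∈ range n, |r u|) + 1) := by
  induction n with
  | zero => simp [anhPot]
  | succ n ih =>
    have h1 := anhPot_step (abs_sum_le_sum_abs r (range n)) (hr n)
    have h2 := div_one_add_le_log_sub (sum_nonneg fun u _ => abs_nonneg (r u) :
      0 ≤ ∑ u ∈ range n, |r u|) (abs_nonneg (r n)) (hr n)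
    simp only [sum_range_succ]
    linarith

/-- Regret against the `i`-th interval of level `k` at round `u`, zero off that interval. -/
noncomputable def gcRegret {α : Type*} (f : ℕ → α → ℝ) (w : ℕ → α)
    (wI : ℕ → ℕ → ℕ → α) (k i u : ℕ) : ℝ :=
  if u / 2 ^ k = i then f u (w u) - f u (wI k i u) else 0

lemma Nat.div_two_pow_eq_iff {k i u : ℕ} :
    u / 2 ^ k = i ↔ i * 2 ^ k ≤ u ∧ u ≤ (i + 1) * 2 ^ k - 1 := by
  have h : 0 < 2 ^ k := by positivity
  have h' : 0 < (i + 1) * 2 ^ k := by positivity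
  rw [Nat.div_eq_iff h, add_mul]
  omega

lemma sum_range_ite_div_eq (g : ℕ → ℝ) {k i n : ℕ} (hn : 1 ≤ n) (hi : n ≤ (i + 1) * 2 ^ k) :
    ∑ u ∈ range n, (if u / 2 ^ k = i then g u else 0) = ∑ u ∈ Icc (i * 2 ^ k) (n - 1), g u := by
  rw [← sum_filter]
  refine sum_congr ?_ fun _ _ => rfl
  ext u
  simp only [mem_filter, mem_range, mem_Icc, Nat.div_two_pow_eq_iff]
  omega

section Regret

variable {α : Type*} (f : ℕ → α → ℝ) (w : ℕ → α) (wI : ℕ → ℕ → ℕ → α)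

lemma sum_gcRegret_eq_aoaMetaR {k t : ℕ} (ht : 1 ≤ t) :
    ∑ u ∈ range t, gcRegret f w wI k (t / 2 ^ k) u = aoaMetaR f w wI k t := by
  unfold gcRegret aoaMetaR
  exact sum_range_ite_div_eq (fun u => f u (w u) - f u (wI k (t / 2 ^ k) u)) ht
    ((Nat.lt_div_mul_add (b := 2 ^ k) (by positivity)).le.trans (by rw [add_mul, one_mul]))

lemma sum_abs_gcRegret_eq_aoaMetaC {k t : ℕ} (ht : 1 ≤ t) :
    ∑ u ∈ range t, |gcRegret f w wI k (t / 2 ^ k) u| = aoaMetaC f w wI k t := by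
  unfold gcRegret aoaMetaC
  simp only [apply_ite abs, abs_zero]
  exact sum_range_ite_div_eq (fun u => |f u (w u) - f u (wI k (t / 2 ^ k) u)|) ht
    ((Nat.lt_div_mul_add (b := 2 ^ k) (by positivity)).le.trans (by rw [add_mul, one_mul]))

lemma aoaMetaC_nonneg (k t : ℕ) : 0 ≤ aoaMetaC f w wI k t :=
  sum_nonneg fun _ _ => abs_nonneg _

lemma sum_anhW_pos {t : ℕ} (ht : 1 ≤ t) :
    0 < ∑ k ∈ gcLevels t, anhW (aoaMetaR f w wI k t) (aoaMetaC f w wI k t) := by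
  refine sum_pos' (fun k _ => anhW_nonneg (aoaMetaC_nonneg f w wI k t)) ⟨0, ?_, ?_⟩
  · simp [gcLevels]
    omega
  · have h : Icc t (t - 1) = ∅ := Icc_eq_empty (by omega)
    simpa [aoaMetaR, aoaMetaC, h] using anhW_zero_pos

lemma aoaWeight_nonneg {k t : ℕ} (ht : 1 ≤ t) : 0 ≤ aoaWeight f w wI k t :=
  div_nonneg (anhW_nonneg (aoaMetaC_nonneg f w wI k t)) (sum_anhW_pos f w wI ht).le

lemma sum_aoaWeight {t : ℕ} (ht : 1 ≤ t) : ∑ k ∈ gcLevels t, aoaWeight f w wI k t = 1 := by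
  unfold aoaWeight
  rw [← sum_div, div_self (sum_anhW_pos f w wI ht).ne']

lemma mem_gcLevels {k t : ℕ} : k ∈ gcLevels t ↔ 2 ^ k ≤ t := by
  have : k < 2 ^ k := Nat.lt_two_pow_self
  simp [gcLevels]
  omega

/-- The weighted instantaneous regrets of all experts sum to a nonpositive number. -/
lemma sum_anhW_mul_gcRegret_nonpos {j t : ℕ} (htj : t ≤ j)
    (hjensen : 1 ≤ t →
      f t (w t) ≤ ∑ k ∈ gcLevels t, aoaWeight f w wI k t * f t (wI k (t / 2 ^ k) t)) :
    ∑ k ∈ range (Nat.log 2 j + 1), ∑ i ∈ Icc 1 j,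
      anhW (∑ u ∈ range t, gcRegret f w wI k i u) (∑ u ∈ range t, |gcRegret f w wI k i u|) *
        gcRegret f w wI k i t ≤ 0 := by
  rcases Nat.eq_zero_or_pos t with rfl | ht
  · refine (sum_eq_zero fun k _ => sum_eq_zero fun i hi => ?_).le
    have h : 0 ≠ i := (Nat.ne_of_gt (mem_Icc.mp hi).1).symm
    simp [gcRegret, h]
  have hinner : ∀ k ∈ range (Nat.log 2 j + 1), (∑ i ∈ Icc 1 j,
      anhW (∑ u ∈ range t, gcRegret f w wI k i u) (∑ u ∈ range t, |gcRegret f w wI k i u|) *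
        gcRegret f w wI k i t) = if 2 ^ k ≤ t then
          anhW (aoaMetaR f w wI k t) (aoaMetaC f w wI k t) *
            (f t (w t) - f t (wI k (t / 2 ^ k) t)) else 0 := by
    intro k _
    split_ifs with h
    · rw [sum_eq_single (t / 2 ^ k)]
      · rw [sum_gcRegret_eq_aoaMetaR f w wI ht, sum_abs_gcRegret_eq_aoaMetaC f w wI ht]
        simp [gcRegret]
      · intro i _ hi
        simp [gcRegret, hi.symm]
      · intro hmem
        exact absurd (mem_Icc.mpr ⟨Nat.div_pos h (by positivity),
          (Nat.div_le_self _ _).trans htj⟩) hmem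
    · refine sum_eq_zero fun i hi => ?_
      have hi0 : 0 ≠ i := (Nat.ne_of_gt (mem_Icc.mp hi).1).symm
      simp [gcRegret, Nat.div_eq_of_lt (not_le.mp h), hi0]
  rw [sum_congr rfl hinner, ← sum_filter]
  have hset : (range (Nat.log 2 j + 1)).filter (fun k => 2 ^ k ≤ t) = gcLevels t := by
    ext k
    rw [mem_gcLevels, mem_filter, mem_range, and_iff_right_iff_imp, Nat.lt_succ_iff]
    exact fun h => (Nat.le_log_iff_pow_le (by norm_num) (by omega)).mpr (h.trans htj)
  rw [hset]
  have hpos := sum_anhW_pos f w wI ht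
  have hj := hjensen ht
  simp only [mul_sub, sum_sub_distrib, ← sum_mul]
  simp only [aoaWeight, div_mul_eq_mul_div, ← sum_div] at hj
  rw [le_div_iff₀ hpos] at hj
  linarith

/-- Potential bound for a single expert, from the sum over all experts. -/
lemma anhPot_gcRegret_le {j k i : ℕ} (hk : k ≤ Nat.log 2 j) (hi : 1 ≤ i) (hij : i ≤ j)
    (hbound : ∀ k i u, 1 ≤ i → |gcRegret f w wI k i u| ≤ 1)
    (hjensen : ∀ t, 1 ≤ t →
      f t (w t) ≤ ∑ k ∈ gcLevels t, aoaWeight f w wI k t * f t (wI k (t / 2 ^ k) t)) :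
    anhPot (∑ u ∈ range (j + 1), gcRegret f w wI k i u)
        (∑ u ∈ range (j + 1), |gcRegret f w wI k i u|) ≤
      ((Nat.log 2 j : ℝ) + 1) * j * ((5 + 3 * Real.log (1 + (j : ℝ))) / 2) := by
  set S : ℕ → ℕ → ℕ → ℝ := fun k i n => ∑ u ∈ range n, gcRegret f w wI k i u with hS
  set T : ℕ → ℕ → ℕ → ℝ := fun k i n => ∑ u ∈ range n, |gcRegret f w wI k i u| with hT
  have hT0 : ∀ k i n, 0 ≤ T k i n := fun k i n => sum_nonneg fun _ _ => abs_nonneg _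
  have hTj : ∀ k i, 1 ≤ i → T k i (j + 1) ≤ j := by
    intro k i hi
    have h0 : |gcRegret f w wI k i 0| = 0 := by
      simp [gcRegret, show (0 : ℕ) ≠ i by omega]
    simp only [hT, sum_range_succ', h0, add_zero]
    refine (sum_le_sum fun u _ => hbound k i (u + 1) hi).trans ?_
    simp
  calc anhPot (S k i (j + 1)) (T k i (j + 1))
      ≤ ∑ i ∈ Icc 1 j, anhPot (S k i (j + 1)) (T k i (j + 1)) :=
        single_le_sum (f := fun i => anhPot (S k i (j + 1)) (T k i (j + 1)))
          (fun i _ => (Real.exp_pos _).le) (mem_Icc.mpr ⟨hi, hij⟩)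
    _ ≤ ∑ k ∈ range (Nat.log 2 j + 1), ∑ i ∈ Icc 1 j, anhPot (S k i (j + 1)) (T k i (j + 1)) :=
        single_le_sum (f := fun k => ∑ i ∈ Icc 1 j, anhPot (S k i (j + 1)) (T k i (j + 1)))
          (fun k _ => sum_nonneg fun i _ => (Real.exp_pos _).le) (mem_range.mpr (by omega))
    _ ≤ ∑ k ∈ range (Nat.log 2 j + 1), ∑ i ∈ Icc 1 j,
          ((∑ t ∈ range (j + 1), anhW (S k i t) (T k i t) * gcRegret f w wI k i t) +
            (5 + 3 * Real.log (1 + (j : ℝ))) / 2) := by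
        refine sum_le_sum fun k _ => sum_le_sum fun i hi => ?_
        have h1 := (mem_Icc.mp hi).1
        have h := anhPot_sum_le (gcRegret f w wI k i) (fun u => hbound k i u h1) (j + 1)
        have hl : Real.log (1 + T k i (j + 1)) ≤ Real.log (1 + (j : ℝ)) :=
          Real.log_le_log (by linarith [hT0 k i (j + 1)]) (by linarith [hTj k i h1])
        have hp : 0 ≤ 1 / (1 + T k i (j + 1)) := by
          have := hT0 k i (j + 1)
          positivity
        simp only [hS, hT] at hl hp ⊢
        linarith
    _ = (∑ t ∈ range (j + 1), ∑ k ∈ range (Nat.log 2 j + 1), ∑ i ∈ Icc 1 j,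
          anhW (S k i t) (T k i t) * gcRegret f w wI k i t) +
          ((Nat.log 2 j : ℝ) + 1) * j * ((5 + 3 * Real.log (1 + (j : ℝ))) / 2) := by
        simp only [sum_add_distrib, sum_const, card_range, Nat.card_Icc, nsmul_eq_mul]
        congr 1
        · rw [sum_comm (s := range (j + 1))]
          exact sum_congr rfl fun k _ => sum_comm
        · push_cast
          ring
    _ ≤ _ := by
        have : (∑ t ∈ range (j + 1), ∑ k ∈ range (Nat.log 2 j + 1), ∑ i ∈ Icc 1 j,
          anhW (S k i t) (T k i t) * gcRegret f w wI k i t) ≤ 0 :=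
          sum_nonpos fun t ht => sum_anhW_mul_gcRegret_nonpos f w wI
            (by have := mem_range.mp ht; omega) (hjensen t)
        linarith

end Regret

lemma sum_inv_mul_succ (N : ℕ) :
    ∑ j ∈ Icc 1 N, 1 / ((j : ℝ) * ((j : ℝ) + 1)) = N / (N + 1) := by
  induction N with
  | zero => simp
  | succ n ih =>
    rw [sum_Icc_succ_top (by omega), ih]
    push_cast
    field_simp
    ring

lemma cAOA_bound {j : ℕ} (hj : 1 ≤ j) {x : ℝ}
    (hx : Real.exp x ≤ ((Nat.log 2 j : ℝ) + 1) * j * ((5 + 3 * Real.log (1 + (j : ℝ))) / 2)) :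
    x ≤ cAOA j := by
  have hj' : (1 : ℝ) ≤ j := by exact_mod_cast hj
  have hl : 0 ≤ Real.log (1 + (j : ℝ)) := Real.log_nonneg (by linarith)
  have hb : (Nat.log 2 j : ℝ) ≤ Real.logb 2 j := by
    simpa using Real.natLog_le_logb j 2
  have h0 : (0 : ℝ) ≤ Nat.log 2 j := Nat.cast_nonneg _
  have hb0 : 0 < 1 + Real.logb 2 j := by linarith
  have hx' : x ≤ Real.log (j * (1 + Real.logb 2 j) * ((5 + 3 * Real.log (1 + (j : ℝ))) / 2)) := by
    rw [Real.le_log_iff_exp_le (by positivity)]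
    refine hx.trans ?_
    rw [mul_comm (_ + 1 : ℝ)]
    gcongr ?_ * ?_ * ?_
    linarith
  rw [Real.log_mul (by positivity) (by positivity), Real.log_mul (by positivity) (by positivity)]
    at hx'
  unfold cAOA
  linarith

/-- Lemma 9, meta-regret of AOA: under the AOA algorithm with
losses valued in `[0,1]`, for every interval `J = [i·2^k, (i+1)·2^k − 1]` of the
geometric covering collection `𝓘`,
`Σ_{t∈J} (f_t(w_t) − f_t(w_{t,J})) ≤ √(3·|J|·c'(max J))`. -/
theorem aoa_meta_regret
    (d : ℕ) (D G : ℝ)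
    (Ω : Set (EuclideanSpace ℝ (Fin d)))
    (hne : Ω.Nonempty) (hcomp : IsCompact Ω) (hconv : Convex ℝ Ω)
    (hdiam : ∀ z ∈ Ω, ∀ z' ∈ Ω, ‖z - z'‖ ≤ D)
    (f : ℕ → EuclideanSpace ℝ (Fin d) → ℝ)
    (hfconv : ∀ t, ConvexOn ℝ Set.univ (f t))
    (hfdiff : ∀ t z, DifferentiableAt ℝ (f t) z)
    (hgrad : ∀ t, ∀ z ∈ Ω, ‖gradient (f t) z‖ ≤ G)
    (hrange : ∀ t, ∀ z ∈ Ω, 0 ≤ f t z ∧ f t z ≤ 1)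
    (proj : EuclideanSpace ℝ (Fin d) → EuclideanSpace ℝ (Fin d))
    (hproj : ∀ z, proj z ∈ Ω ∧ ∀ z' ∈ Ω, ‖proj z - z‖ ≤ ‖z' - z‖)
    (y : ℕ → ℕ → ℕ → ℕ → EuclideanSpace ℝ (Fin d))
    (q : ℕ → ℕ → ℕ → ℕ → ℝ)
    (wI : ℕ → ℕ → ℕ → EuclideanSpace ℝ (Fin d))
    (w : ℕ → EuclideanSpace ℝ (Fin d))
    (hy0 : ∀ k i j, y k i j (i * 2 ^ k) ∈ Ω)
    (hyup : ∀ k i j t, i * 2 ^ k ≤ t → t + 1 ≤ (i + 1) * 2 ^ k - 1 →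
      y k i j (t + 1) = proj (y k i j t - aderEta D G (2 ^ k) j • gradient (f t) (y k i j t)))
    (hq0 : ∀ k i j, 1 ≤ j → j ≤ aderN (2 ^ k) →
      q k i j (i * 2 ^ k) = (1 + 1 / (aderN (2 ^ k) : ℝ)) / ((j : ℝ) * ((j : ℝ) + 1)))
    (hqup : ∀ k i j t, i * 2 ^ k ≤ t → t + 1 ≤ (i + 1) * 2 ^ k - 1 →
      q k i j (t + 1) = q k i j t * Real.exp (-(aderAlpha (2 ^ k)) * f t (y k i j t)) /
        ∑ j' ∈ Finset.Icc 1 (aderN (2 ^ k)),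
          q k i j' t * Real.exp (-(aderAlpha (2 ^ k)) * f t (y k i j' t)))
    (hwI : ∀ k i t, wI k i t = ∑ j ∈ Finset.Icc 1 (aderN (2 ^ k)), q k i j t • y k i j t)
    (hw : ∀ t, 1 ≤ t → w t = ∑ k ∈ gcLevels t, aoaWeight f w wI k t • wI k (t / 2 ^ k) t)
    (k i : ℕ) (hi : 1 ≤ i) :
    ∑ t ∈ Finset.Icc (i * 2 ^ k) ((i + 1) * 2 ^ k - 1), (f t (w t) - f t (wI k i t))
      ≤ Real.sqrt (3 * (((i + 1) * 2 ^ k - 1 - i * 2 ^ k + 1 : ℕ) : ℝ) *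
          cAOA ((i + 1) * 2 ^ k - 1)) := by
  have hy : ∀ k i j t, t / 2 ^ k = i → y k i j t ∈ Ω := by
    intro k i j t hti
    obtain ⟨h1, h2⟩ := Nat.div_two_pow_eq_iff.mp hti
    rcases h1.eq_or_lt with h | h
    · rw [← h]
      exact hy0 k i j
    · obtain ⟨t, rfl⟩ : ∃ s, t = s + 1 := ⟨t - 1, by omega⟩
      rw [hyup k i j t (by omega) h2]
      exact (hproj _).1
  have hq : ∀ k i t, i * 2 ^ k ≤ t → t ≤ (i + 1) * 2 ^ k - 1 →
      (∀ j ∈ Icc 1 (aderN (2 ^ k)), 0 < q k i j t) ∧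
        ∑ j ∈ Icc 1 (aderN (2 ^ k)), q k i j t = 1 := by
    intro k i t h
    have hN : 1 ≤ aderN (2 ^ k) := by simp [aderN]
    have hN' : (0 : ℝ) < aderN (2 ^ k) := by exact_mod_cast hN
    induction t, h using Nat.le_induction with
    | base =>
      intro _
      have h : ∀ j ∈ Icc 1 (aderN (2 ^ k)), q k i j (i * 2 ^ k) =
          (1 + 1 / (aderN (2 ^ k) : ℝ)) * (1 / ((j : ℝ) * ((j : ℝ) + 1))) := fun j hj => by
        rw [hq0 k i j (mem_Icc.mp hj).1 (mem_Icc.mp hj).2, mul_one_div]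
      refine ⟨fun j hj => ?_, ?_⟩
      · have : (0 : ℝ) < j := by exact_mod_cast (mem_Icc.mp hj).1
        rw [h j hj]
        positivity
      · rw [sum_congr rfl h, ← mul_sum, sum_inv_mul_succ]
        field_simp
    | succ t ht ih =>
      intro hle
      obtain ⟨hpos, -⟩ := ih (by omega)
      have hden : 0 < ∑ j' ∈ Icc 1 (aderN (2 ^ k)),
          q k i j' t * Real.exp (-(aderAlpha (2 ^ k)) * f t (y k i j' t)) :=
        sum_pos (fun j hj => mul_pos (hpos j hj) (Real.exp_pos _)) ⟨1, by simpa using hN⟩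
      refine ⟨fun j hj => ?_, ?_⟩
      · rw [hqup k i j t ht hle]
        exact div_pos (mul_pos (hpos j hj) (Real.exp_pos _)) hden
      · rw [sum_congr rfl fun j _ => hqup k i j t ht hle, ← sum_div, div_self hden.ne']
  have hwImem : ∀ k t, wI k (t / 2 ^ k) t ∈ Ω := by
    intro k t
    obtain ⟨h1, h2⟩ := Nat.div_two_pow_eq_iff.mp (rfl : t / 2 ^ k = t / 2 ^ k)
    obtain ⟨hpos, hsum⟩ := hq k _ t h1 h2
    rw [hwI]
    exact hconv.sum_mem (fun j hj => (hpos j hj).le) hsum fun j _ => hy k _ j t rfl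
  have hwmem : ∀ t, 1 ≤ t → w t ∈ Ω := by
    intro t ht
    rw [hw t ht]
    exact hconv.sum_mem (fun k _ => aoaWeight_nonneg f w wI ht) (sum_aoaWeight f w wI ht)
      fun k _ => hwImem k t
  have hjensen : ∀ t, 1 ≤ t →
      f t (w t) ≤ ∑ k ∈ gcLevels t, aoaWeight f w wI k t * f t (wI k (t / 2 ^ k) t) := by
    intro t ht
    conv_lhs => rw [hw t ht]
    exact (hfconv t).map_sum_le (fun k _ => aoaWeight_nonneg f w wI ht)
      (sum_aoaWeight f w wI ht) fun k _ => Set.mem_univ _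
  have hbound : ∀ k i u, 1 ≤ i → |gcRegret f w wI k i u| ≤ 1 := by
    intro k i u hi
    unfold gcRegret
    split_ifs with h
    · have hu : 1 ≤ u := by
        by_contra hu
        have hu0 : u = 0 := by omega
        rw [hu0, Nat.zero_div] at h
        omega
      have h1 := hrange u _ (hwmem u hu)
      have h2 := hrange u _ (hwImem k u)
      rw [h] at h2
      rw [abs_le]
      constructor <;> linarith
    · simp
  set j := (i + 1) * 2 ^ k - 1 with hj
  have h2k : 1 ≤ 2 ^ k := Nat.one_le_two_pow
  have hi2k : i ≤ i * 2 ^ k := Nat.le_mul_of_pos_right i h2k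
  have h2ki : 2 ^ k ≤ i * 2 ^ k := Nat.le_mul_of_pos_left _ hi
  have hjsucc : j + 1 = i * 2 ^ k + 2 ^ k := by
    rw [hj, add_mul]
    omega
  have hpot := anhPot_gcRegret_le f w wI (j := j) (k := k) (i := i)
    ((Nat.le_log_iff_pow_le (by norm_num) (by omega)).mpr (by omega)) hi (by omega) hbound hjensen
  have hS : ∑ u ∈ range (j + 1), gcRegret f w wI k i u =
      ∑ t ∈ Icc (i * 2 ^ k) j, (f t (w t) - f t (wI k i t)) :=
    sum_range_ite_div_eq (fun u => f u (w u) - f u (wI k i u)) (by omega)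
      (by rw [add_mul]; omega)
  have hlen : j - i * 2 ^ k + 1 = 2 ^ k := by omega
  have hT : ∑ u ∈ range (j + 1), |gcRegret f w wI k i u| ≤ (2 ^ k : ℕ) := by
    have h : ∑ u ∈ range (j + 1), |gcRegret f w wI k i u| =
        ∑ t ∈ Icc (i * 2 ^ k) j, |gcRegret f w wI k i t| := by
      rw [← Nat.add_sub_cancel (n := j) (m := 1),
        ← sum_range_ite_div_eq (k := k) (i := i) _ (by omega) (by rw [add_mul]; omega)]
      refine sum_congr rfl fun u _ => ?_
      unfold gcRegret
      split_ifs <;> simp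
    rw [h]
    refine (sum_le_sum fun u _ => hbound k i u hi).trans ?_
    rw [sum_const, Nat.card_Icc, nsmul_eq_mul, mul_one]
    exact_mod_cast (by omega : j + 1 - i * 2 ^ k ≤ 2 ^ k)
  rw [hlen, ← hS]
  set S := ∑ u ∈ range (j + 1), gcRegret f w wI k i u
  set C := ∑ u ∈ range (j + 1), |gcRegret f w wI k i u|
  have hSC : |S| ≤ C := abs_sum_le_sum_abs _ _
  have hc := cAOA_bound (by omega : 1 ≤ j) hpot
  rcases le_or_gt S 0 with h | h
  · exact h.trans (Real.sqrt_nonneg _)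
  · have hC : 0 < C := h.trans_le ((le_abs_self S).trans hSC)
    have hcpos : 0 ≤ cAOA j := le_trans (by positivity) hc
    rw [max_eq_left h.le, div_le_iff₀ (by positivity)] at hc
    refine Real.le_sqrt_of_sq_le (hc.trans ?_)
    nlinarith [mul_le_mul_of_nonneg_left hT hcpos]
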